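/- arXiv:2304.11024 — 7 statements merged into one kernel-verified Lean document; each statement's English description precedes it below -/
import Mathlib

section
/- Define the vector field V : ℝ × ℝ → ℝ × ℝ by V(y, x) = (y·(2x − 1), w(x) − c·α(x)·β(y)). Then there is exactly one point (y₀, x₀) with y₀ ≥ 0 and V(y₀, x₀) = (0, 0); moreover this point satisfies x₀ = 1/2, y₀ > 0, and c·β(y₀) = w(1/2). -/
/-- A differentiable function whose derivative is negative at every point of the level set
`f = v` takes the value `v` at most once. -/
lemma eq_of_deriv_neg_on_level {f : ℝ → ℝ} (hf : Differentiable ℝ f) {v : ℝ}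
    (hd : ∀ y, f y = v → deriv f y < 0) {a b : ℝ} (ha : f a = v) (hb : f b = v) : a = b := by
  wlog hab : a < b generalizing a b
  · rcases (not_lt.mp hab).eq_or_lt with h | h
    · exact h.symm
    · exact (this hb ha h).symm
  exfalso
  have hle : ∀ x ∈ Set.Icc a b, f x ≤ v :=
    image_le_of_deriv_right_lt_deriv_boundary (B := fun _ => v) (B' := fun _ => 0)
      hf.continuous.continuousOn (fun x _ => (hf x).hasDerivAt.hasDerivWithinAt) ha.le
      (fun x => hasDerivAt_const x v) (fun x _ hx => hd x hx)
  have hslope : ∀ᶠ x in nhdsWithin b (Set.Iio b), slope f b x < 0 :=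
    ((hasDerivWithinAt_iff_tendsto_slope' (by simp)).mp
      (hf b).hasDerivAt.hasDerivWithinAt).eventually_lt_const (hd b hb)
  obtain ⟨x, hx, hxab⟩ := (hslope.and (Ioo_mem_nhdsLT hab)).exists
  have hxv := hle x ⟨hxab.1.le, hxab.2.le⟩
  rw [slope_def_field, hb] at hx
  exact hx.not_ge (div_nonneg_of_nonpos (by linarith) (by linarith [hxab.2]))


/-- The planar vector field `V (y, x) = (y*(2x-1), w x - c * α x * β y)` has
exactly one zero `(y₀, x₀)` with `y₀ ≥ 0`; moreover it satisfies `x₀ = 1/2`, `y₀ > 0` and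
`c * β y₀ = w (1/2)`. -/
theorem stmt_0 (w α β : ℝ → ℝ) (c : ℝ)
    (hw : ContDiff ℝ 1 w)
    (hw_pos : ∀ x ∈ Set.Ioo (0:ℝ) 1, 0 < w x)
    (hw_neg : ∀ x, x ∉ Set.Icc (0:ℝ) 1 → w x < 0)
    (hα : ContDiff ℝ 1 α)
    (hα01 : ∀ x, α x ∈ Set.Icc (0:ℝ) 1)
    (hα1 : ∀ x ∈ Set.Icc (0:ℝ) 1, α x = 1)
    (hβ : ContDiff ℝ 1 β)
    (hβ01 : ∀ y, β y ∈ Set.Icc (0:ℝ) 1)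
    (hβ0 : β 0 = 1)
    (hβY : ∃ Y > (0:ℝ), β Y = 0)
    (hβ' : ∀ y, 0 < β y → β y < 1 → deriv β y < 0)
    (hc : 0 < c)
    (hwc : ∀ x ∈ Set.Icc (0:ℝ) 1, w x < c) :
    ∃ p : ℝ × ℝ,
      (0 ≤ p.1 ∧ (p.1 * (2 * p.2 - 1), w p.2 - c * α p.2 * β p.1) = (0, 0)) ∧
      p.2 = 1 / 2 ∧ 0 < p.1 ∧ c * β p.1 = w (1 / 2) ∧
      ∀ q : ℝ × ℝ,
        (0 ≤ q.1 ∧ (q.1 * (2 * q.2 - 1), w q.2 - c * α q.2 * β q.1) = (0, 0)) → q = p := by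
  obtain ⟨Y, hY, hβY⟩ := hβY
  have hmem : (1 / 2 : ℝ) ∈ Set.Icc (0:ℝ) 1 := by norm_num
  have hv0 : 0 < w (1 / 2) := hw_pos _ (by norm_num)
  have hvc : w (1 / 2) < c := hwc _ hmem
  have hr0 : 0 < w (1 / 2) / c := div_pos hv0 hc
  have hr1 : w (1 / 2) / c < 1 := (div_lt_one hc).mpr hvc
  obtain ⟨y, hy, hβy⟩ : w (1 / 2) / c ∈ β '' Set.Icc 0 Y :=
    intermediate_value_Icc' hY.le hβ.continuous.continuousOn
      ⟨by rw [hβY]; exact hr0.le, by rw [hβ0]; exact hr1.le⟩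
  have hcβ : c * β y = w (1 / 2) := by rw [hβy]; field_simp
  have hypos : 0 < y := by
    refine hy.1.lt_of_ne ?_
    rintro rfl
    rw [hβ0] at hβy
    exact hr1.ne' hβy
  refine ⟨(y, 1 / 2), ⟨hy.1, ?_⟩, rfl, hypos, hcβ, ?_⟩
  · simp only [hα1 _ hmem, mul_one, hcβ, sub_self, Prod.mk.injEq, and_true]
    norm_num
  · rintro ⟨z, x⟩ ⟨hz, hV⟩
    obtain ⟨h1, h2⟩ := Prod.mk.inj hV
    dsimp only at hz h1 h2
    rcases mul_eq_zero.mp h1 with rfl | hx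
    · exfalso
      rw [hβ0, mul_one] at h2
      by_cases hx : x ∈ Set.Icc (0:ℝ) 1
      · rw [hα1 x hx] at h2
        linarith [hwc x hx]
      · linarith [hw_neg x hx, mul_nonneg hc.le (hα01 x).1]
    · obtain rfl : x = 1 / 2 := by linarith
      rw [hα1 _ hmem, mul_one] at h2
      have hβz : β z = w (1 / 2) / c := by
        rw [eq_div_iff hc.ne']
        linarith
      have hzy : z = y := eq_of_deriv_neg_on_level (hβ.differentiable one_ne_zero)
        (fun t ht => hβ' t (ht ▸ hr0) (ht ▸ hr1)) hβz hβy
      rw [hzy]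
end

section
/- Define the vector field V : ℝ × ℝ × (Fin m → ℝ) → ℝ × ℝ × (Fin m → ℝ) by V(y, x, u) = (y·(2x − 1), w(x) − c·α(x)·β(y)·δ(u), (ε₀·u₀, …, ε_{m−1}·u_{m−1})). Then there is exactly one point (y₀, x₀, u₀) with y₀ ≥ 0 at which V vanishes; moreover this point satisfies x₀ = 1/2, u₀ = 0, y₀ > 0, and c·β(y₀) = w(1/2). -/
/-- A differentiable function with values in `[0, 1]` whose derivative is negative wherever its
value lies in `(0, 1)` is antitone: at the remaining points it has a global extremum. -/
theorem antitone_of_mem_Icc_of_deriv_neg {f : ℝ → ℝ} (hf : Differentiable ℝ f)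
    (h01 : ∀ y, f y ∈ Set.Icc (0 : ℝ) 1)
    (h : ∀ y, 0 < f y → f y < 1 → deriv f y < 0) : Antitone f := by
  refine antitone_of_deriv_nonpos hf fun y => ?_
  rcases (h01 y).1.eq_or_lt with h0 | h0
  · have hmin : IsLocalMin f y := Filter.Eventually.of_forall fun z => h0 ▸ (h01 z).1
    exact hmin.deriv_eq_zero.le
  rcases (h01 y).2.eq_or_lt with h1 | h1
  · have hmax : IsLocalMax f y := Filter.Eventually.of_forall fun z => h1.symm ▸ (h01 z).2
    exact hmax.deriv_eq_zero.le
  · exact (h y h0 h1).le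

/-- An antitone function whose derivative is negative wherever its value lies in `(0, 1)` takes
each value in `(0, 1)` at most once. -/
theorem Antitone.eq_of_eq_of_deriv_neg {f : ℝ → ℝ} (hanti : Antitone f) (hf : Continuous f)
    (h : ∀ y, 0 < f y → f y < 1 → deriv f y < 0) {a b : ℝ} (hab : f a = f b)
    (h0 : 0 < f a) (h1 : f a < 1) : a = b := by
  wlog hlt : a < b generalizing a b
  · rcases (not_lt.mp hlt).eq_or_lt with hba | hba
    · exact hba.symm
    · exact (this hab.symm (hab ▸ h0) (hab ▸ h1) hba).symm
  obtain ⟨z, hz, hz'⟩ := exists_deriv_eq_zero hlt hf.continuousOn hab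
  have hza : f z = f a := le_antisymm (hanti hz.1.le) (hab ▸ hanti hz.2.le)
  exact absurd hz' (h z (hza ▸ h0) (hza ▸ h1)).ne


/-- The vector field
`V (y, x, u) = (y*(2x-1), w x - c * α x * β y * δ u, (ε i * u i)_i)` on
`ℝ × ℝ × (Fin m → ℝ)` has exactly one zero `(y₀, x₀, u₀)` with `y₀ ≥ 0`; moreover it
satisfies `x₀ = 1/2`, `u₀ = 0`, `y₀ > 0` and `c * β y₀ = w (1/2)`. -/
theorem stmt_1 (m : ℕ) (hm : 1 ≤ m) (w α β : ℝ → ℝ) (c : ℝ)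
    (ε : Fin m → ℝ) (δ : (Fin m → ℝ) → ℝ)
    (hw : ContDiff ℝ 1 w)
    (hw_pos : ∀ x ∈ Set.Ioo (0:ℝ) 1, 0 < w x)
    (hw_neg : ∀ x, x ∉ Set.Icc (0:ℝ) 1 → w x < 0)
    (hα : ContDiff ℝ 1 α)
    (hα01 : ∀ x, α x ∈ Set.Icc (0:ℝ) 1)
    (hα1 : ∀ x ∈ Set.Icc (0:ℝ) 1, α x = 1)
    (hβ : ContDiff ℝ 1 β)
    (hβ01 : ∀ y, β y ∈ Set.Icc (0:ℝ) 1)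
    (hβ0 : β 0 = 1)
    (hβY : ∃ Y > (0:ℝ), β Y = 0)
    (hβ' : ∀ y, 0 < β y → β y < 1 → deriv β y < 0)
    (hc : 0 < c)
    (hwc : ∀ x ∈ Set.Icc (0:ℝ) 1, w x < c)
    (hε : ∀ i, ε i = -1 ∨ ε i = 1)
    (hδ : Continuous δ)
    (hδ0 : δ 0 = 1) :
    ∃ p : ℝ × ℝ × (Fin m → ℝ),
      (0 ≤ p.1 ∧
        (p.1 * (2 * p.2.1 - 1), w p.2.1 - c * α p.2.1 * β p.1 * δ p.2.2,
          fun i => ε i * p.2.2 i) = ((0 : ℝ), (0 : ℝ), (0 : Fin m → ℝ))) ∧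
      p.2.1 = 1 / 2 ∧ p.2.2 = 0 ∧ 0 < p.1 ∧ c * β p.1 = w (1 / 2) ∧
      ∀ q : ℝ × ℝ × (Fin m → ℝ),
        (0 ≤ q.1 ∧
          (q.1 * (2 * q.2.1 - 1), w q.2.1 - c * α q.2.1 * β q.1 * δ q.2.2,
            fun i => ε i * q.2.2 i) = ((0 : ℝ), (0 : ℝ), (0 : Fin m → ℝ))) → q = p := by
  have half_mem : (1 / 2 : ℝ) ∈ Set.Icc (0 : ℝ) 1 := by norm_num
  have hv0 : 0 < w (1 / 2) := hw_pos _ (by norm_num)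
  have hv1 : w (1 / 2) < c := hwc _ half_mem
  have hanti : Antitone β :=
    antitone_of_mem_Icc_of_deriv_neg (hβ.differentiable one_ne_zero) hβ01 hβ'
  obtain ⟨Y, hY, hβY⟩ := hβY
  obtain ⟨y₀, hy₀, hβy₀⟩ : w (1 / 2) / c ∈ β '' Set.Ioo 0 Y := by
    refine intermediate_value_Ioo' hY.le hβ.continuous.continuousOn ?_
    rw [hβY, hβ0]
    exact ⟨div_pos hv0 hc, (div_lt_one hc).2 hv1⟩
  have hcβ : c * β y₀ = w (1 / 2) := by rw [hβy₀]; field_simp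
  refine ⟨(y₀, 1 / 2, 0), ⟨hy₀.1.le, ?_⟩, rfl, rfl, hy₀.1, hcβ, ?_⟩
  · refine Prod.ext ?_ (Prod.ext ?_ ?_)
    · norm_num
    · change w (1 / 2) - c * α (1 / 2) * β y₀ * δ 0 = 0
      rw [hα1 _ half_mem, hδ0, mul_one, mul_one, hcβ, sub_self]
    · funext i
      simp
  · rintro ⟨y, x, u⟩ ⟨-, hV⟩
    simp only [Prod.mk.injEq] at hV
    obtain ⟨hyx, hwx, hεu⟩ := hV
    have hu : u = 0 := by
      funext i
      have hε0 : ε i ≠ 0 := by rcases hε i with h | h <;> norm_num [h]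
      exact (mul_eq_zero.mp (congrFun hεu i)).resolve_left hε0
    subst hu
    rw [hδ0, mul_one] at hwx
    rcases mul_eq_zero.mp hyx with rfl | hx
    · rw [hβ0, mul_one] at hwx
      by_cases hx : x ∈ Set.Icc (0 : ℝ) 1
      · rw [hα1 x hx] at hwx
        linarith [hwc x hx]
      · linarith [hw_neg x hx, mul_nonneg hc.le (hα01 x).1]
    · obtain rfl : x = 1 / 2 := by linarith
      rw [hα1 _ half_mem, mul_one] at hwx
      have hβy : β y₀ = β y := mul_left_cancel₀ hc.ne' (by linarith)
      rw [hanti.eq_of_eq_of_deriv_neg hβ.continuous hβ' hβy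
        (hβy₀ ▸ div_pos hv0 hc) (hβy₀ ▸ (div_lt_one hc).2 hv1)]
end

section
/- Define f : ℝ × ℝ × (Fin m → ℝ) → ℝ by f(y, x, u) = −y² + x² + Σᵢ εᵢ·uᵢ², and the vector field ξ(y, x, u) = (y·(2x − 1), w(x), (ε₀·u₀, …, ε_{m−1}·u_{m−1})). Then for every point p = (y, x, u) with x < 1/2, the directional derivative of f along ξ at p, namely (Df)(p)(ξ(p)) = −2y²·(2x − 1) + 2x·w(x) + 2·Σᵢ uᵢ², is nonnegative, and it equals zero if and only if p = (0, 0, 0). -/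
/-- The directional derivative of the diagonal quadratic form `-y² + x² + ∑ εᵢ uᵢ²`. -/
lemma fderiv_morse_normal_form {m : ℕ} (ε : Fin m → ℝ) (p v : ℝ × ℝ × (Fin m → ℝ)) :
    fderiv ℝ (fun q : ℝ × ℝ × (Fin m → ℝ) =>
        -q.1 ^ 2 + q.2.1 ^ 2 + ∑ i, ε i * (q.2.2 i) ^ 2) p v =
      -2 * p.1 * v.1 + 2 * p.2.1 * v.2.1 + 2 * ∑ i, ε i * p.2.2 i * v.2.2 i := by
  have hy : HasFDerivAt (fun q : ℝ × ℝ × (Fin m → ℝ) => q.1)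
      (ContinuousLinearMap.fst ℝ ℝ (ℝ × (Fin m → ℝ))) p := hasFDerivAt_fst
  have hxu : HasFDerivAt (fun q : ℝ × ℝ × (Fin m → ℝ) => q.2)
      (ContinuousLinearMap.snd ℝ ℝ (ℝ × (Fin m → ℝ))) p := hasFDerivAt_snd
  have hu (i : Fin m) := hasFDerivAt_pi'.1 hxu.snd i
  have h := ((hy.pow 2).neg.add (hxu.fst.pow 2)).add
    (HasFDerivAt.fun_sum (u := Finset.univ) fun i _ => ((hu i).pow 2).const_mul (ε i))
  refine (congrArg (fun L => L v) h.fderiv).trans ?_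
  simp [Finset.mul_sum]
  exact Finset.sum_congr rfl fun i _ => by ring

/-- A function positive on `(0, 1)` and negative off `[0, 1]` has the sign of its argument
to the left of `1`. -/
lemma mul_pos_of_sign {w : ℝ → ℝ} (hw_pos : ∀ x ∈ Set.Ioo (0 : ℝ) 1, 0 < w x)
    (hw_neg : ∀ x, x ∉ Set.Icc (0 : ℝ) 1 → w x < 0) {x : ℝ} (hx : x < 1) (hx0 : x ≠ 0) :
    0 < x * w x := by
  rcases lt_or_gt_of_ne hx0 with h | h
  · exact mul_pos_of_neg_of_neg h (hw_neg x fun hmem => absurd hmem.1 (not_le.2 h))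
  · exact mul_pos h (hw_pos x ⟨h, hx⟩)

/-- For `f (y, x, u) = -y² + x² + ∑ εᵢ uᵢ²` and the model vector field
`ξ (y, x, u) = (y(2x-1), w x, (εᵢ uᵢ)ᵢ)`, at every point `p = (y, x, u)` with `x < 1/2`
the directional derivative of `f` along `ξ` equals
`-2y²(2x-1) + 2x·w(x) + 2∑ uᵢ²`, is nonnegative, and vanishes iff `p = (0,0,0)`. -/
theorem stmt_5 (m : ℕ) (w : ℝ → ℝ) (ε : Fin m → ℝ)
    (hw : ContDiff ℝ 1 w)
    (hw_pos : ∀ x ∈ Set.Ioo (0:ℝ) 1, 0 < w x)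
    (hw_neg : ∀ x, x ∉ Set.Icc (0:ℝ) 1 → w x < 0)
    (hε : ∀ i, ε i = -1 ∨ ε i = 1) :
    ∀ p : ℝ × ℝ × (Fin m → ℝ), p.2.1 < 1 / 2 →
      fderiv ℝ
          (fun q : ℝ × ℝ × (Fin m → ℝ) =>
            -q.1 ^ 2 + q.2.1 ^ 2 + ∑ i, ε i * (q.2.2 i) ^ 2) p
          (p.1 * (2 * p.2.1 - 1), w p.2.1, fun i => ε i * p.2.2 i) =
        -2 * p.1 ^ 2 * (2 * p.2.1 - 1) + 2 * p.2.1 * w p.2.1 + 2 * (∑ i, (p.2.2 i) ^ 2) ∧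
      0 ≤ -2 * p.1 ^ 2 * (2 * p.2.1 - 1) + 2 * p.2.1 * w p.2.1 + 2 * (∑ i, (p.2.2 i) ^ 2) ∧
      (-2 * p.1 ^ 2 * (2 * p.2.1 - 1) + 2 * p.2.1 * w p.2.1 + 2 * (∑ i, (p.2.2 i) ^ 2) = 0 ↔
        p = ((0 : ℝ), (0 : ℝ), (0 : Fin m → ℝ))) := by
  rintro ⟨y, x, u⟩ hx
  dsimp only at hx ⊢
  have hy : 0 ≤ y ^ 2 * (1 - 2 * x) := mul_nonneg (sq_nonneg y) (by linarith)
  have hxw : 0 ≤ x * w x := by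
    rcases eq_or_ne x 0 with rfl | hx0
    · simp
    · exact (mul_pos_of_sign hw_pos hw_neg (by linarith) hx0).le
  have hu : 0 ≤ ∑ i, u i ^ 2 := Finset.sum_nonneg fun i _ => sq_nonneg (u i)
  refine ⟨?_, by linarith, fun h => ?_, fun h => ?_⟩
  · rw [fderiv_morse_normal_form]
    have hsq : ∑ i, ε i * u i * (ε i * u i) = ∑ i, u i ^ 2 :=
      Finset.sum_congr rfl fun i _ => by rcases hε i with h | h <;> rw [h] <;> ring
    rw [hsq]
    ring
  · have hx0 : x = 0 := by
      by_contra hx0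
      have := mul_pos_of_sign hw_pos hw_neg (by linarith) hx0
      linarith
    have hy0 : y = 0 := by
      have hz : y ^ 2 * (1 - 2 * x) = 0 := by linarith
      simpa [hx0] using hz
    have hu0 : u = 0 := by
      have hz : ∑ i, u i ^ 2 = 0 := by linarith
      rw [Finset.sum_eq_zero_iff_of_nonneg fun i _ => sq_nonneg (u i)] at hz
      exact funext fun i => pow_eq_zero_iff two_ne_zero |>.1 (hz i (Finset.mem_univ i))
    rw [hx0, hy0, hu0]
  · obtain ⟨rfl, rfl, rfl⟩ : y = 0 ∧ x = 0 ∧ u = 0 := by simpa using h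
    simp
end

section
/- There exists δ > 0 such that for every point p = (s, t) ∈ ℝ × ℝ with 0 < ‖p‖ < δ, one has s·F₁(s, t) − t·F₂(s, t) > 0, where F = (F₁, F₂). Equivalently, the derivative of the function g(s, t) = (s² − t²)/2 along F is strictly positive on a punctured neighborhood of the origin. -/
/-- If `F : ℝ × ℝ → ℝ × ℝ` fixes the origin and is differentiable there with
derivative `(s, t) ↦ (c₊ s, c₋ t)`, `c₋ < 0 < c₊`, then on a small punctured neighborhood
of the origin one has `s·F₁(s,t) - t·F₂(s,t) > 0`, i.e. the derivative of the Lyapunov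
function `g(s,t) = (s² - t²)/2` along `F` is strictly positive there. -/
theorem stmt_9 (F : ℝ × ℝ → ℝ × ℝ) (cp cm : ℝ) (L : ℝ × ℝ →L[ℝ] ℝ × ℝ)
    (hF0 : F (0, 0) = (0, 0))
    (hFd : HasFDerivAt F L (0, 0))
    (hL : ∀ v : ℝ × ℝ, L v = (cp * v.1, cm * v.2))
    (hcm : cm < 0) (hcp : 0 < cp) :
    ∃ δ > (0 : ℝ), ∀ p : ℝ × ℝ, 0 < ‖p‖ → ‖p‖ < δ →
      0 < p.1 * (F p).1 - p.2 * (F p).2 := by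
  obtain ⟨m, hm, hmp, hmm⟩ : ∃ m > (0 : ℝ), m ≤ cp ∧ m ≤ -cm :=
    ⟨min cp (-cm), lt_min hcp (neg_pos.mpr hcm), min_le_left _ _, min_le_right _ _⟩
  have ho := hFd.isLittleO.bound (show 0 < m / 4 by positivity)
  obtain ⟨δ, hδ, hball⟩ := Metric.eventually_nhds_iff.mp ho
  refine ⟨δ, hδ, fun p hp hpδ => ?_⟩
  have hzero : ((0, 0) : ℝ × ℝ) = 0 := rfl
  have hbound : ‖F p - L p‖ ≤ m / 4 * ‖p‖ := by
    have h := hball (y := p) (by rwa [hzero, dist_zero_right])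
    rwa [hF0, hzero, sub_zero, sub_zero] at h
  set e := F p - L p with he
  have hF1 : (F p).1 = cp * p.1 + e.1 := by simp [he, hL]
  have hF2 : (F p).2 = cm * p.2 + e.2 := by simp [he, hL]
  have hs : |p.1 * e.1| ≤ m / 4 * ‖p‖ ^ 2 := by
    rw [abs_mul]
    calc |p.1| * |e.1| ≤ ‖p‖ * (m / 4 * ‖p‖) :=
          mul_le_mul (norm_fst_le p) ((norm_fst_le e).trans hbound) (abs_nonneg _) hp.le
      _ = m / 4 * ‖p‖ ^ 2 := by ring
  have ht : |p.2 * e.2| ≤ m / 4 * ‖p‖ ^ 2 := by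
    rw [abs_mul]
    calc |p.2| * |e.2| ≤ ‖p‖ * (m / 4 * ‖p‖) :=
          mul_le_mul (norm_snd_le p) ((norm_snd_le e).trans hbound) (abs_nonneg _) hp.le
      _ = m / 4 * ‖p‖ ^ 2 := by ring
  have hnorm : ‖p‖ ^ 2 ≤ p.1 ^ 2 + p.2 ^ 2 := by
    rw [Prod.norm_def]
    rcases max_choice ‖p.1‖ ‖p.2‖ with h | h <;> rw [h, Real.norm_eq_abs, sq_abs]
    · linarith [sq_nonneg p.2]
    · linarith [sq_nonneg p.1]
  have hquad : m * ‖p‖ ^ 2 ≤ cp * p.1 ^ 2 + -cm * p.2 ^ 2 := by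
    linarith [mul_le_mul_of_nonneg_left hnorm hm.le,
      mul_le_mul_of_nonneg_right hmp (sq_nonneg p.1),
      mul_le_mul_of_nonneg_right hmm (sq_nonneg p.2)]
  have hpos : 0 < m * ‖p‖ ^ 2 := by positivity
  rw [hF1, hF2]
  linarith [(abs_le.mp hs).1, (abs_le.mp ht).2]
end

section
/- Define the vector field V : ℝ × ℝ → ℝ × ℝ by V(y, x) = (y·(2x − 1), w(x) − c·α(x)·β(y)), and let y₀ > 0 satisfy c·β(y₀) = w(1/2). Suppose γ : ℝ → ℝ × ℝ satisfies, for every t ≥ 0, that γ is differentiable at t with γ'(t) = V(γ(t)) and that the first coordinate of γ(t) is nonnegative, and suppose the set {γ(t) : t ≥ 0} is bounded. Then γ(t) converges to (y₀, 1/2) as t → +∞. -/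
open Filter Topology Set

/-- A monotone function on a half-line which is bounded above converges at infinity. -/
theorem exists_tendsto_atTop_of_monotoneOn {f : ℝ → ℝ} {T B : ℝ}
    (hf : MonotoneOn f (Ici T)) (hB : ∀ t ≥ T, f t ≤ B) :
    ∃ l, Tendsto f atTop (𝓝 l) := by
  have hm : Monotone fun t => f (max t T) := fun a b hab =>
    hf (le_max_right a T) (le_max_right b T) (max_le_max_right T hab)
  refine ⟨⨆ t, f (max t T), ?_⟩
  refine (tendsto_atTop_ciSup hm ⟨B, ?_⟩).congr' ?_
  · rintro _ ⟨t, rfl⟩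
    exact hB _ (le_max_right t T)
  · filter_upwards [eventually_ge_atTop T] with t ht
    rw [max_eq_left ht]

/-- An antitone function on a half-line which is bounded below converges at infinity. -/
theorem exists_tendsto_atTop_of_antitoneOn {f : ℝ → ℝ} {T B : ℝ}
    (hf : AntitoneOn f (Ici T)) (hB : ∀ t ≥ T, B ≤ f t) :
    ∃ l, Tendsto f atTop (𝓝 l) := by
  obtain ⟨l, hl⟩ := exists_tendsto_atTop_of_monotoneOn (f := fun t => -f t) (T := T) (B := -B)
    hf.neg (fun t ht => neg_le_neg (hB t ht))
  exact ⟨-l, by simpa using hl.neg⟩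

/-- If a function and its derivative both converge at infinity, the derivative tends to zero. -/
theorem eq_zero_of_tendsto_of_hasDerivAt {f f' : ℝ → ℝ} {T l m : ℝ}
    (hd : ∀ t ≥ T, HasDerivAt f (f' t) t) (hf : Tendsto f atTop (𝓝 l))
    (hf' : Tendsto f' atTop (𝓝 m)) : m = 0 := by
  have hex : ∀ t ≥ T, ∃ ξ ∈ Ioo t (t + 1), f' ξ = f (t + 1) - f t := by
    intro t ht
    obtain ⟨ξ, hξ, h⟩ := exists_hasDerivAt_eq_slope f f' (lt_add_one t)
      (fun u hu => (hd u (ht.trans hu.1)).continuousAt.continuousWithinAt)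
      (fun u hu => hd u (ht.trans hu.1.le))
    exact ⟨ξ, hξ, by simpa using h⟩
  choose! ξ hξ hslope using hex
  have hξt : Tendsto ξ atTop atTop := by
    refine tendsto_atTop_mono' _ ?_ tendsto_id
    filter_upwards [eventually_ge_atTop T] with t ht using (hξ t ht).1.le
  have h1 : Tendsto (fun t => f (t + 1) - f t) atTop (𝓝 (l - l)) :=
    (hf.comp (tendsto_atTop_add_const_right _ 1 tendsto_id)).sub hf
  have h2 : Tendsto (fun t => f (t + 1) - f t) atTop (𝓝 m) := by
    refine (hf'.comp hξt).congr' ?_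
    filter_upwards [eventually_ge_atTop T] with t ht using hslope t ht
  simpa using tendsto_nhds_unique h2 h1

/-- A nonvanishing continuous function on a half-line has constant sign. -/
theorem pos_or_neg_of_ne_zero_on_Ici {s : ℝ → ℝ} {T : ℝ} (hs : ContinuousOn s (Ici T))
    (h0 : ∀ t ≥ T, s t ≠ 0) : (∀ t ≥ T, 0 < s t) ∨ (∀ t ≥ T, s t < 0) := by
  by_contra! h
  obtain ⟨⟨a, ha, hsa⟩, ⟨b, hb, hsb⟩⟩ := h
  obtain ⟨t, ht, hst⟩ := isPreconnected_Ici.intermediate_value (s := Ici T) ha hb hs ⟨hsa, hsb⟩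
  exact h0 t ht hst

/-- For a solution of the cooperative planar linear system `s' = 2 q`, `q' = a q + b s` with
`b ≥ 0`, either `s q` is eventually positive, or `s q ≤ 0` at all times. -/
theorem eventually_mul_pos_or_mul_nonpos {s q a b : ℝ → ℝ} (ha : ContinuousOn a (Ici 0))
    (hb : ∀ t ≥ 0, 0 ≤ b t) (hs : ∀ t ≥ 0, HasDerivAt s (2 * q t) t)
    (hq : ∀ t ≥ 0, HasDerivAt q (a t * q t + b t * s t) t) :
    (∃ T ≥ 0, ∀ t ≥ T, 0 < s t * q t) ∨ ∀ t ≥ 0, s t * q t ≤ 0 := by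
  have hac : Continuous fun t => a (max t 0) :=
    ha.comp_continuous (by fun_prop) fun t => le_max_right t 0
  set A : ℝ → ℝ := fun t => ∫ u in (0:ℝ)..t, a (max u 0)
  have hAd : ∀ t ≥ 0, HasDerivAt A (a t) t := fun t ht => by
    simpa [max_eq_left ht] using hac.integral_hasStrictDerivAt 0 t |>.hasDerivAt
  have hP : ∀ t ≥ 0, HasDerivAt (fun t => s t * q t * Real.exp (-A t))
      ((2 * q t ^ 2 + b t * s t ^ 2) * Real.exp (-A t)) t := fun t ht => by
    refine (((hs t ht).mul (hq t ht)).mul (hAd t ht).neg.exp).congr_deriv ?_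
    simp only [Pi.mul_apply, Pi.neg_apply]
    ring
  have hmono : MonotoneOn (fun t => s t * q t * Real.exp (-A t)) (Ici 0) := by
    refine monotoneOn_of_hasDerivWithinAt_nonneg (convex_Ici 0)
      (fun t ht => (hP t ht).continuousAt.continuousWithinAt)
      (fun t ht => (hP t (interior_subset ht)).hasDerivWithinAt) fun t ht => ?_
    have := hb t (interior_subset ht)
    positivity
  by_cases h : ∀ t ≥ 0, s t * q t ≤ 0
  · exact Or.inr h
  · push Not at h
    obtain ⟨T, hT, hpos⟩ := h
    refine Or.inl ⟨T, hT, fun t ht => ?_⟩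
    have h1 := hmono (mem_Ici.2 hT) (mem_Ici.2 (hT.trans ht)) ht
    have h2 : 0 < s t * q t * Real.exp (-A t) := lt_of_lt_of_le (by positivity) h1
    exact pos_of_mul_pos_left h2 (Real.exp_pos _).le

/-- In a cooperative planar linear system `s' = 2 q`, `q' = a q + b s` with `b ≥ 0`, the component
`s` is eventually of constant sign and eventually monotone. -/
theorem eventually_constant_sign_and_monotone {s q a b : ℝ → ℝ} (ha : ContinuousOn a (Ici 0))
    (hb : ∀ t ≥ 0, 0 ≤ b t) (hs : ∀ t ≥ 0, HasDerivAt s (2 * q t) t)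
    (hq : ∀ t ≥ 0, HasDerivAt q (a t * q t + b t * s t) t) :
    ∃ T ≥ 0, ((∀ t ≥ T, 0 ≤ s t) ∨ (∀ t ≥ T, s t ≤ 0)) ∧
      (MonotoneOn s (Ici T) ∨ AntitoneOn s (Ici T)) := by
  have hsc : ∀ T ≥ 0, ContinuousOn s (Ici T) := fun T hT t ht =>
    (hs t (hT.trans ht)).continuousAt.continuousWithinAt
  have mono : ∀ T ≥ 0, (∀ t ≥ T, 0 ≤ q t) → MonotoneOn s (Ici T) := fun T hT h =>
    monotoneOn_of_hasDerivWithinAt_nonneg (convex_Ici T) (hsc T hT)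
      (fun t ht => (hs t (hT.trans (interior_subset ht))).hasDerivWithinAt)
      (fun t ht => by have := h t (interior_subset ht); positivity)
  have anti : ∀ T ≥ 0, (∀ t ≥ T, q t ≤ 0) → AntitoneOn s (Ici T) := fun T hT h =>
    antitoneOn_of_hasDerivWithinAt_nonpos (convex_Ici T) (hsc T hT)
      (fun t ht => (hs t (hT.trans (interior_subset ht))).hasDerivWithinAt)
      (fun t ht => by have := h t (interior_subset ht); linarith)
  rcases eventually_mul_pos_or_mul_nonpos ha hb hs hq with ⟨T, hT, hpos⟩ | hneg
  · refine ⟨T, hT, ?_⟩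
    rcases pos_or_neg_of_ne_zero_on_Ici (hsc T hT)
      fun t ht h => by simpa [h] using hpos t ht with h | h
    · exact ⟨Or.inl fun t ht => (h t ht).le, Or.inl <| mono T hT fun t ht =>
        (pos_of_mul_pos_right (hpos t ht) (h t ht).le).le⟩
    · refine ⟨Or.inr fun t ht => (h t ht).le, Or.inr <| anti T hT fun t ht => ?_⟩
      have h1 := hpos t ht
      have h2 := h t ht
      by_contra! h3
      nlinarith
  · have hsq : AntitoneOn (fun t => s t ^ 2) (Ici 0) := by
      refine antitoneOn_of_hasDerivWithinAt_nonpos (convex_Ici 0) ((hsc 0 le_rfl).pow 2)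
        (fun t ht => ((hs t (interior_subset ht)).pow 2).hasDerivWithinAt) fun t ht => ?_
      have := hneg t (interior_subset ht)
      norm_num
      nlinarith
    by_cases hz : ∃ T ≥ 0, s T = 0
    · obtain ⟨T, hT, hsT⟩ := hz
      have hzero : ∀ t ≥ T, s t = 0 := fun t ht => by
        have h1 := hsq (mem_Ici.2 hT) (mem_Ici.2 (hT.trans ht)) ht
        simp only [hsT] at h1
        exact pow_eq_zero_iff two_ne_zero |>.1 (le_antisymm (by simpa using h1) (sq_nonneg _))
      exact ⟨T, hT, Or.inl fun t ht => (hzero t ht).ge, Or.inl fun u hu v hv _ => by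
        rw [hzero u hu, hzero v hv]⟩
    · push Not at hz
      refine ⟨0, le_rfl, ?_⟩
      rcases pos_or_neg_of_ne_zero_on_Ici (hsc 0 le_rfl) hz with h | h
      · refine ⟨Or.inl fun t ht => (h t ht).le, Or.inr <| anti 0 le_rfl fun t ht => ?_⟩
        exact nonpos_of_mul_nonpos_right (hneg t ht) (h t ht)
      · refine ⟨Or.inr fun t ht => (h t ht).le, Or.inl <| mono 0 le_rfl fun t ht => ?_⟩
        have h1 := hneg t ht
        have h2 := h t ht
        by_contra! h3
        nlinarith

/-- A `[0, 1]`-valued function whose derivative is negative wherever its values lie in `(0, 1)` has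
nonpositive derivative everywhere. -/
theorem deriv_nonpos_of_mem_Icc {β : ℝ → ℝ} (hβ01 : ∀ y, β y ∈ Icc (0:ℝ) 1)
    (hβ' : ∀ y, 0 < β y → β y < 1 → deriv β y < 0) (y : ℝ) : deriv β y ≤ 0 := by
  rcases (hβ01 y).1.eq_or_lt with h0 | h0
  · have : IsLocalMin β y := Eventually.of_forall fun u => h0 ▸ (hβ01 u).1
    exact this.deriv_eq_zero.le
  rcases (hβ01 y).2.eq_or_lt with h1 | h1
  · have : IsLocalMax β y := Eventually.of_forall fun u => h1.symm ▸ (hβ01 u).2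
    exact this.deriv_eq_zero.le
  · exact (hβ' y h0 h1).le

/-- A differentiable `[0, 1]`-valued function whose derivative is negative wherever its values lie
in `(0, 1)` takes each value in `(0, 1)` at most once. -/
theorem eq_of_eq_of_mem_Ioo {β : ℝ → ℝ} (hβ : Differentiable ℝ β)
    (hβ01 : ∀ y, β y ∈ Icc (0:ℝ) 1) (hβ' : ∀ y, 0 < β y → β y < 1 → deriv β y < 0) {u v : ℝ}
    (huv : β u = β v) (hv : β v ∈ Ioo (0:ℝ) 1) : u = v := by
  have hanti : Antitone β := antitone_of_deriv_nonpos hβ (deriv_nonpos_of_mem_Icc hβ01 hβ')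
  have key : ∀ u v, β u = β v → β v ∈ Ioo (0:ℝ) 1 → ¬ u < v := by
    intro u v huv hv hlt
    have hconst : ∀ t ∈ Ioo u v, β t = β v := fun t ht =>
      le_antisymm (huv ▸ hanti ht.1.le) (hanti ht.2.le)
    obtain ⟨m, hm⟩ := nonempty_Ioo.2 hlt
    have h1 : β =ᶠ[𝓝 m] fun _ => β v := by
      filter_upwards [Ioo_mem_nhds hm.1 hm.2] with t ht using hconst t ht
    have h2 : deriv β m = 0 := by rw [h1.deriv_eq, deriv_const]
    have h3 := hβ' m (by rw [hconst m hm]; exact hv.1) (by rw [hconst m hm]; exact hv.2)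
    exact h3.ne h2
  exact le_antisymm (not_lt.1 (key v u huv.symm (huv ▸ hv))) (not_lt.1 (key u v huv hv))


/-- Every forward trajectory of the planar vector field
`V (y, x) = (y(2x-1), w x - c α(x) β(y))` which stays in a bounded region of the half-plane
`{y ≥ 0}` converges to the unique interior zero `(y₀, 1/2)`. -/
theorem stmt_10 (w α β : ℝ → ℝ) (c y₀ : ℝ)
    (hw : ContDiff ℝ 1 w)
    (hw_pos : ∀ x ∈ Set.Ioo (0:ℝ) 1, 0 < w x)
    (hw_neg : ∀ x, x ∉ Set.Icc (0:ℝ) 1 → w x < 0)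
    (hα : ContDiff ℝ 1 α)
    (hα01 : ∀ x, α x ∈ Set.Icc (0:ℝ) 1)
    (hα1 : ∀ x ∈ Set.Icc (0:ℝ) 1, α x = 1)
    (hβ : ContDiff ℝ 1 β)
    (hβ01 : ∀ y, β y ∈ Set.Icc (0:ℝ) 1)
    (hβ0 : β 0 = 1)
    (hβY : ∃ Y > (0:ℝ), β Y = 0)
    (hβ' : ∀ y, 0 < β y → β y < 1 → deriv β y < 0)
    (hc : 0 < c)
    (hwc : ∀ x ∈ Set.Icc (0:ℝ) 1, w x < c)
    (hy₀ : 0 < y₀) (hy₀β : c * β y₀ = w (1 / 2))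
    (γ : ℝ → ℝ × ℝ)
    (hγ : ∀ t ≥ (0 : ℝ),
      HasDerivAt γ
        ((γ t).1 * (2 * (γ t).2 - 1), w (γ t).2 - c * α (γ t).2 * β (γ t).1) t ∧
      0 ≤ (γ t).1)
    (hbdd : Bornology.IsBounded (γ '' Set.Ici 0)) :
    Filter.Tendsto γ Filter.atTop (nhds (y₀, 1 / 2)) := by
  have hβd : Differentiable ℝ β := hβ.differentiable one_ne_zero
  have hwd : Differentiable ℝ w := hw.differentiable one_ne_zero
  have hαd : Differentiable ℝ α := hα.differentiable one_ne_zero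
  have hβn := deriv_nonpos_of_mem_Icc hβ01 hβ'
  set y : ℝ → ℝ := fun t => (γ t).1
  set x : ℝ → ℝ := fun t => (γ t).2
  set q : ℝ → ℝ := fun t => w (x t) - c * α (x t) * β (y t)
  have hy0 : ∀ t ≥ 0, 0 ≤ y t := fun t ht => (hγ t ht).2
  have hyd : ∀ t ≥ 0, HasDerivAt y (y t * (2 * x t - 1)) t := fun t ht =>
    (hasFDerivAt_fst (𝕜 := ℝ) (p := γ t)).comp_hasDerivAt t (hγ t ht).1
  have hxd : ∀ t ≥ 0, HasDerivAt x (q t) t := fun t ht =>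
    (hasFDerivAt_snd (𝕜 := ℝ) (p := γ t)).comp_hasDerivAt t (hγ t ht).1
  have hyc : ContinuousOn y (Ici 0) := fun t ht => (hyd t ht).continuousAt.continuousWithinAt
  have hxc : ContinuousOn x (Ici 0) := fun t ht => (hxd t ht).continuousAt.continuousWithinAt
  have hsd : ∀ t ≥ 0, HasDerivAt (fun t => 2 * x t - 1) (2 * q t) t := fun t ht =>
    ((hxd t ht).const_mul 2).sub_const 1
  have hqd : ∀ t ≥ 0, HasDerivAt q
      ((deriv w (x t) - c * deriv α (x t) * β (y t)) * q t +
        (c * α (x t) * -deriv β (y t) * y t) * (2 * x t - 1)) t := fun t ht => by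
    have h1 := (hwd (x t)).hasDerivAt.comp t (hxd t ht)
    have h2 := (hαd (x t)).hasDerivAt.comp t (hxd t ht)
    have h3 := (hβd (y t)).hasDerivAt.comp t (hyd t ht)
    refine (h1.sub ((h2.const_mul c).mul h3)).congr_deriv ?_
    simp only [Function.comp_apply]
    ring
  have hac : ContinuousOn (fun t => deriv w (x t) - c * deriv α (x t) * β (y t)) (Ici 0) := by
    have h1 := (hw.continuous_deriv le_rfl).comp_continuousOn hxc
    have h2 := (hα.continuous_deriv le_rfl).comp_continuousOn hxc
    have h3 := hβ.continuous.comp_continuousOn hyc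
    exact h1.sub ((continuousOn_const.mul h2).mul h3)
  have hb0 : ∀ t ≥ 0, 0 ≤ c * α (x t) * -deriv β (y t) * y t := fun t ht =>
    mul_nonneg (mul_nonneg (mul_nonneg hc.le (hα01 _).1) (neg_nonneg.2 (hβn _))) (hy0 t ht)
  obtain ⟨T, hT, hsign, hmono⟩ := eventually_constant_sign_and_monotone hac hb0 hsd hqd
  obtain ⟨B, hB⟩ := hbdd.exists_norm_le
  have hyB : ∀ t ≥ 0, |y t| ≤ B := fun t ht =>
    (norm_fst_le (γ t)).trans (hB _ (mem_image_of_mem γ ht))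
  have hxB : ∀ t ≥ 0, |x t| ≤ B := fun t ht =>
    (norm_snd_le (γ t)).trans (hB _ (mem_image_of_mem γ ht))
  obtain ⟨yl, hyl⟩ : ∃ l, Tendsto y atTop (𝓝 l) := by
    have hyc' : ContinuousOn y (Ici T) := hyc.mono (Ici_subset_Ici.2 hT)
    have hyd' : ∀ t ∈ interior (Ici T),
        HasDerivWithinAt y (y t * (2 * x t - 1)) (interior (Ici T)) t := fun t ht =>
      (hyd t (hT.trans (interior_subset ht))).hasDerivWithinAt
    rcases hsign with h | h
    · refine exists_tendsto_atTop_of_monotoneOn (T := T) (B := B) ?_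
        fun t ht => (abs_le.1 (hyB t (hT.trans ht))).2
      exact monotoneOn_of_hasDerivWithinAt_nonneg (convex_Ici T) hyc' hyd' fun t ht =>
        mul_nonneg (hy0 t (hT.trans (interior_subset ht))) (h t (interior_subset ht))
    · refine exists_tendsto_atTop_of_antitoneOn (T := T) (B := 0) ?_
        fun t ht => hy0 t (hT.trans ht)
      exact antitoneOn_of_hasDerivWithinAt_nonpos (convex_Ici T) hyc' hyd' fun t ht =>
        mul_nonpos_of_nonneg_of_nonpos (hy0 t (hT.trans (interior_subset ht)))
          (h t (interior_subset ht))
  obtain ⟨xl, hxl⟩ : ∃ l, Tendsto x atTop (𝓝 l) := by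
    rcases hmono with h | h
    · refine exists_tendsto_atTop_of_monotoneOn (T := T) (B := B) (fun u hu v hv huv => ?_)
        fun t ht => (abs_le.1 (hxB t (hT.trans ht))).2
      have := h hu hv huv
      linarith
    · refine exists_tendsto_atTop_of_antitoneOn (T := T) (B := -B) (fun u hu v hv huv => ?_)
        fun t ht => (abs_le.1 (hxB t (hT.trans ht))).1
      have := h hu hv huv
      linarith
  have hyl0 : 0 ≤ yl := ge_of_tendsto hyl <| by
    filter_upwards [eventually_ge_atTop 0] with t ht using hy0 t ht
  have hzy : yl * (2 * xl - 1) = 0 :=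
    eq_zero_of_tendsto_of_hasDerivAt hyd hyl (hyl.mul ((hxl.const_mul 2).sub_const 1))
  have hzx : w xl - c * α xl * β yl = 0 :=
    eq_zero_of_tendsto_of_hasDerivAt hxd hxl
      (((hw.continuous.tendsto xl).comp hxl).sub
        ((((hα.continuous.tendsto xl).comp hxl).const_mul c).mul
          ((hβ.continuous.tendsto yl).comp hyl)))
  have hhalf : (1 / 2 : ℝ) ∈ Ioo (0:ℝ) 1 := by norm_num
  have hlim : yl = y₀ ∧ xl = 1 / 2 := by
    rcases mul_eq_zero.1 hzy with h0 | h0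
    · exfalso
      rw [h0, hβ0] at hzx
      by_cases hmem : xl ∈ Icc (0:ℝ) 1
      · rw [hα1 _ hmem] at hzx
        linarith [hwc _ hmem]
      · linarith [hw_neg _ hmem, mul_nonneg hc.le (hα01 xl).1]
    · have hxl2 : xl = 1 / 2 := by linarith
      refine ⟨?_, hxl2⟩
      rw [hxl2, hα1 _ (Ioo_subset_Icc_self hhalf), ← hy₀β] at hzx
      have hβeq : β yl = β y₀ := mul_left_cancel₀ hc.ne' (by linarith)
      refine eq_of_eq_of_mem_Ioo hβd hβ01 hβ' hβeq ⟨?_, ?_⟩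
      · exact pos_of_mul_pos_right (hy₀β ▸ hw_pos _ hhalf) hc.le
      · have := hwc _ (Ioo_subset_Icc_self hhalf)
        rw [← hy₀β] at this
        nlinarith
  rw [← hlim.1, ← hlim.2]
  exact hyl.prodMk_nhds hxl
end

section
/- Suppose that every curve γ₂ : ℝ → ℝ × ℝ which satisfies γ₂'(t) = (a(γ₂(t)), b(γ₂(t))) for all t ≥ 0 and has bounded image {γ₂(t) : t ≥ 0} converges to z₂ as t → +∞. Define V : (ℝ × ℝ) × (Fin m → ℝ) → (ℝ × ℝ) × (Fin m → ℝ) by V(p, u) = ((a(p), b(p)), (ε₀·u₀, …, ε_{m−1}·u_{m−1})). Then every curve γ : ℝ → (ℝ × ℝ) × (Fin m → ℝ) which satisfies γ'(t) = V(γ(t)) for all t ≥ 0 and has bounded image {γ(t) : t ≥ 0} converges to (z₂, 0) as t → +∞. -/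
/-- A forward solution of the linear equation `f' = c f` is an exponential. -/
theorem eq_mul_exp_of_hasDerivAt {f : ℝ → ℝ} {c : ℝ}
    (hf : ∀ t ≥ (0 : ℝ), HasDerivAt f (c * f t) t) {t : ℝ} (ht : 0 ≤ t) :
    f t = f 0 * Real.exp (c * t) := by
  have hd : ∀ s ≥ (0 : ℝ), HasDerivAt (fun s => f s * Real.exp (-(c * s))) 0 s := by
    intro s hs
    have he : HasDerivAt (fun s : ℝ => Real.exp (-(c * s))) (Real.exp (-(c * s)) * -(c * 1)) s :=
      ((hasDerivAt_id s).const_mul c).neg.exp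
    exact ((hf s hs).mul he).congr_deriv (by ring)
  have h := constant_of_has_deriv_right_zero
    (fun s hs => (hd s hs.1).continuousAt.continuousWithinAt)
    (fun s hs => (hd s hs.1).hasDerivWithinAt) t ⟨ht, le_rfl⟩
  simp only [mul_zero, neg_zero, Real.exp_zero, mul_one] at h
  rw [← h, mul_assoc, ← Real.exp_add, neg_add_cancel, Real.exp_zero, mul_one]

/-- A bounded forward solution of `f' = c f` with `c ≠ 0` tends to zero. -/
theorem tendsto_zero_of_hasDerivAt_of_isBounded {f : ℝ → ℝ} {c : ℝ} (hc : c ≠ 0)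
    (hf : ∀ t ≥ (0 : ℝ), HasDerivAt f (c * f t) t)
    (hb : Bornology.IsBounded (f '' Set.Ici 0)) :
    Filter.Tendsto f Filter.atTop (nhds 0) := by
  have heq : (fun t => f 0 * Real.exp (c * t)) =ᶠ[Filter.atTop] f := by
    filter_upwards [Filter.eventually_ge_atTop 0] with t ht
    exact (eq_mul_exp_of_hasDerivAt hf ht).symm
  refine Filter.Tendsto.congr' heq ?_
  rcases hc.lt_or_gt with hc | hc
  · simpa using (Real.tendsto_exp_atBot.comp
      (Filter.tendsto_id.const_mul_atTop_of_neg hc)).const_mul (f 0)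
  · suffices h0 : f 0 = 0 by simp [h0]
    by_contra h0
    obtain ⟨C, hC⟩ := hb.exists_norm_le
    have hexp : Filter.Tendsto (fun t : ℝ => |f 0| * Real.exp (c * t)) Filter.atTop Filter.atTop :=
      (Real.tendsto_exp_atTop.comp
        (Filter.tendsto_id.const_mul_atTop hc)).const_mul_atTop (abs_pos.mpr h0)
    obtain ⟨t, htC, ht⟩ :=
      ((hexp.eventually_gt_atTop C).and (Filter.eventually_ge_atTop 0)).exists
    have hle := hC (f t) ⟨t, ht, rfl⟩
    rw [eq_mul_exp_of_hasDerivAt hf ht, Real.norm_eq_abs, abs_mul, Real.abs_exp] at hle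
    exact absurd hle htC.not_ge


/-- If every bounded forward trajectory of the planar vector field
`(a, b)` converges to `z₂`, then every bounded forward trajectory of the product vector field
`V (p, u) = ((a p, b p), (εᵢ uᵢ)ᵢ)` on `(ℝ × ℝ) × (Fin m → ℝ)` converges to `(z₂, 0)`. -/
theorem stmt_11 (a b : ℝ × ℝ → ℝ) (ha : Continuous a) (hb : Continuous b)
    (z₂ : ℝ × ℝ) (m : ℕ) (hm : 1 ≤ m) (ε : Fin m → ℝ)
    (hε : ∀ i, ε i = -1 ∨ ε i = 1)
    (hplanar : ∀ γ₂ : ℝ → ℝ × ℝ,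
      (∀ t ≥ (0 : ℝ), HasDerivAt γ₂ (a (γ₂ t), b (γ₂ t)) t) →
      Bornology.IsBounded (γ₂ '' Set.Ici 0) →
      Filter.Tendsto γ₂ Filter.atTop (nhds z₂)) :
    ∀ γ : ℝ → (ℝ × ℝ) × (Fin m → ℝ),
      (∀ t ≥ (0 : ℝ),
        HasDerivAt γ ((a (γ t).1, b (γ t).1), fun i => ε i * (γ t).2 i) t) →
      Bornology.IsBounded (γ '' Set.Ici 0) →
      Filter.Tendsto γ Filter.atTop (nhds (z₂, (0 : Fin m → ℝ))) := by
  intro γ hγ hbdd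
  refine Filter.Tendsto.prodMk_nhds (hplanar (fun t => (γ t).1) (fun t ht => (hγ t ht).fst) ?_)
    (tendsto_pi_nhds.mpr fun i => ?_)
  · simpa only [Set.image_image] using hbdd.image_fst
  · have hi : ε i ≠ 0 := by rcases hε i with h | h <;> simp [h]
    refine tendsto_zero_of_hasDerivAt_of_isBounded hi
      (fun t ht => hasDerivAt_pi.mp (hγ t ht).snd i) ?_
    simpa only [Set.image_image, Function.eval] using
      Bornology.forall_isBounded_image_eval_iff.mpr hbdd.image_snd i
end

section
/- Let κ : ℝ → ℝ be any function such that for all x ∈ (0, 1) one has κ(x) > 0 and β(κ(x)) = w(x)/c. Then for every x ∈ (0, 1), β'(κ(x)) ≠ 0 and κ is differentiable at x with derivative κ'(x) = w'(x) / (c·β'(κ(x))). -/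
open Filter Topology

/-- A differentiable function with values in `[0, 1]` that has negative derivative wherever its value
lies in `(0, 1)` is antitone: at the values `0` and `1` it has an extremum. -/
lemma antitone_of_mem_Icc_of_deriv_neg_s15 {β : ℝ → ℝ} (hd : Differentiable ℝ β)
    (hβ01 : ∀ y, β y ∈ Set.Icc (0 : ℝ) 1)
    (hβ' : ∀ y, 0 < β y → β y < 1 → deriv β y < 0) : Antitone β := by
  refine antitone_of_deriv_nonpos hd fun y => ?_
  rcases (hβ01 y).1.eq_or_lt with h0 | h0
  · have hmin : IsLocalMin β y := Eventually.of_forall fun z => h0 ▸ (hβ01 z).1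
    exact hmin.deriv_eq_zero.le
  rcases (hβ01 y).2.eq_or_lt with h1 | h1
  · have hmax : IsLocalMax β y := Eventually.of_forall fun z => h1.symm ▸ (hβ01 z).2
    exact hmax.deriv_eq_zero.le
  · exact (hβ' y h0 h1).le

/-- An antitone differentiable function is strictly decreasing between two points one of which
has value `v`, if its derivative does not vanish on the level set of `v`. -/
lemma Antitone.lt_of_deriv_ne_zero {β : ℝ → ℝ} (hanti : Antitone β) (hc : Continuous β)
    {a b v : ℝ} (hab : a < b) (hv : β a = v ∨ β b = v)
    (hne : ∀ y, β y = v → deriv β y ≠ 0) : β b < β a := by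
  refine (hanti hab.le).lt_of_ne fun heq => ?_
  obtain ⟨z, hz, hz0⟩ := exists_deriv_eq_zero hab hc.continuousOn heq.symm
  have h1 := hanti hz.1.le
  have h2 := hanti hz.2.le
  refine hne z ?_ hz0
  rcases hv with hv | hv <;> linarith

/-- A right inverse `κ` of an antitone function `β` along a continuous function `u` is continuous
at `x` if `β` is strictly decreasing at `κ x`. -/
lemma Antitone.continuousAt_of_comp_eventuallyEq {β u κ : ℝ → ℝ} {x : ℝ} (hanti : Antitone β)
    (hu : ContinuousAt u x) (hκ : ∀ᶠ t in 𝓝 x, β (κ t) = u t)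
    (hl : ∀ y < κ x, β (κ x) < β y) (hr : ∀ y > κ x, β y < β (κ x)) : ContinuousAt κ x := by
  have hx : β (κ x) = u x := hκ.self_of_nhds
  refine tendsto_order.2 ⟨fun a ha => ?_, fun b hb => ?_⟩
  · filter_upwards [hκ, hu.eventually_lt_const (hx ▸ hl a ha)] with t ht hlt
    by_contra! hle
    exact absurd (hanti hle) (by rw [ht]; exact hlt.not_ge)
  · filter_upwards [hκ, hu.eventually_const_lt (hx ▸ hr b hb)] with t ht hlt
    by_contra! hle
    exact absurd (hanti hle) (by rw [ht]; exact hlt.not_ge)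

/-- Implicit differentiation of `β ∘ κ = u` for a continuous `κ`. -/
lemma HasStrictDerivAt.hasDerivAt_of_comp_eventuallyEq {β u κ : ℝ → ℝ} {x β' u' : ℝ}
    (hβ : HasStrictDerivAt β β' (κ x)) (hne : β' ≠ 0) (hu : HasDerivAt u u' x)
    (hcont : ContinuousAt κ x) (hκ : ∀ᶠ t in 𝓝 x, β (κ t) = u t) :
    HasDerivAt κ (β'⁻¹ * u') x := by
  have hinv := (hβ.to_localInverse hne).hasDerivAt
  rw [hκ.self_of_nhds] at hinv
  refine (hinv.comp x hu).congr_of_eventuallyEq ?_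
  have hleft := (hβ.hasStrictFDerivAt_equiv hne).eventually_left_inverse
  filter_upwards [hκ, hcont.eventually hleft] with t ht hlt
  rw [Function.comp_apply, ← ht]
  exact hlt.symm

/-- If `κ : ℝ → ℝ` satisfies `κ x > 0` and `β (κ x) = w x / c` for all
`x ∈ (0, 1)` (so `κ` parametrizes the nullcline `Γ_x^κ`), then for every `x ∈ (0, 1)` one has
`β' (κ x) ≠ 0` and `κ` is differentiable at `x` with `κ' x = w' x / (c · β' (κ x))`. -/
theorem stmt_15 (w β : ℝ → ℝ) (c : ℝ) (κ : ℝ → ℝ)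
    (hw : ContDiff ℝ 1 w)
    (hw_pos : ∀ x ∈ Set.Ioo (0:ℝ) 1, 0 < w x)
    (hw_neg : ∀ x, x ∉ Set.Icc (0:ℝ) 1 → w x < 0)
    (hβ : ContDiff ℝ 1 β)
    (hβ01 : ∀ y, β y ∈ Set.Icc (0:ℝ) 1)
    (hβ0 : β 0 = 1)
    (hβY : ∃ Y > (0:ℝ), β Y = 0)
    (hβ' : ∀ y, 0 < β y → β y < 1 → deriv β y < 0)
    (hc : 0 < c)
    (hwc : ∀ x ∈ Set.Icc (0:ℝ) 1, w x < c)
    (hκ : ∀ x ∈ Set.Ioo (0:ℝ) 1, 0 < κ x ∧ β (κ x) = w x / c) :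
    ∀ x ∈ Set.Ioo (0:ℝ) 1,
      deriv β (κ x) ≠ 0 ∧ HasDerivAt κ (deriv w x / (c * deriv β (κ x))) x := by
  intro x hx
  have hd : Differentiable ℝ β := hβ.differentiable one_ne_zero
  have hanti := antitone_of_mem_Icc_of_deriv_neg_s15 hd hβ01 hβ'
  have hv0 : 0 < β (κ x) := by
    rw [(hκ x hx).2]
    exact div_pos (hw_pos x hx) hc
  have hv1 : β (κ x) < 1 := by
    rw [(hκ x hx).2, div_lt_one hc]
    exact hwc x (Set.Ioo_subset_Icc_self hx)
  have hlevel : ∀ y, β y = β (κ x) → deriv β y ≠ 0 := fun y hy =>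
    (hβ' y (hy ▸ hv0) (hy ▸ hv1)).ne
  have hne := hlevel _ rfl
  have hu : HasDerivAt (fun t => w t / c) (deriv w x / c) x :=
    (hw.differentiable one_ne_zero x).hasDerivAt.div_const c
  have hev : ∀ᶠ t in 𝓝 x, β (κ t) = w t / c := by
    filter_upwards [Ioo_mem_nhds hx.1 hx.2] with t ht using (hκ t ht).2
  have hcont : ContinuousAt κ x :=
    hanti.continuousAt_of_comp_eventuallyEq hu.continuousAt hev
      (fun y hy => hanti.lt_of_deriv_ne_zero hd.continuous hy (.inr rfl) hlevel)
      (fun y hy => hanti.lt_of_deriv_ne_zero hd.continuous hy (.inl rfl) hlevel)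
  refine ⟨hne, ?_⟩
  convert (hβ.contDiffAt.hasStrictDerivAt one_ne_zero).hasDerivAt_of_comp_eventuallyEq hne hu
    hcont hev using 1
  field_simp
end
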